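/- There exists a constant c > 0 such that for every sufficiently large n ∈ 16ℕ the following holds: if w : 𝕋 → ℝ is a C² function with w − w'' = (∂_x u_{0,n})² on 𝕋, then Σ_{j∈ℕ(n)} 2^j ‖Δ_j(∂_x w)‖_{L^∞(𝕋)} ≥ c (log n)². -/

import Mathlib

open MeasureTheory Filter Function
open scoped ENNReal NNReal

noncomputable section

/-- The Fourier coefficient `û(ξ) = ∫_{-π}^{π} e^{-i x ξ} u(x) dx` of a `2π`-periodic
function on the torus. -/
def fCoeff (u : ℝ → ℂ) (ξ : ℤ) : ℂ :=
  ∫ x in (-Real.pi)..Real.pi, Complex.exp (-Complex.I * x * ξ) * u x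

/-- A Littlewood–Paley cutoff function: smooth, even, `0 ≤ χ ≤ 1`, `χ = 1` on `[-3/4,3/4]`,
`supp χ ⊆ (-4/3, 4/3)`, nonincreasing on `[0,∞)`. -/
structure LPCutoff where
  χ : ℝ → ℝ
  smooth : ContDiff ℝ (⊤ : ℕ∞) χ
  even : ∀ x, χ (-x) = χ x
  nonneg : ∀ x, 0 ≤ χ x
  le_one : ∀ x, χ x ≤ 1
  eq_one : ∀ x ∈ Set.Icc (-(3/4) : ℝ) (3/4 : ℝ), χ x = 1
  supp : ∀ x, χ x ≠ 0 → x ∈ Set.Ioo (-(4/3) : ℝ) (4/3 : ℝ)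
  decay : AntitoneOn χ (Set.Ici 0)

/-- `φ(ξ) = χ(ξ/2) - χ(ξ)`. -/
def LPCutoff.phi (c : LPCutoff) (x : ℝ) : ℝ := c.χ (x / 2) - c.χ x

/-- The dyadic block `Δ_j u` (for `j ≥ -1`). -/
def LPblock (c : LPCutoff) (j : ℤ) (u : ℝ → ℂ) (x : ℝ) : ℂ :=
  if j = -1 then
    (1 / (2 * Real.pi)) * ∑' ξ : ℤ, (c.χ ξ : ℂ) * fCoeff u ξ * Complex.exp (Complex.I * x * ξ)
  else
    (1 / (2 * Real.pi)) *
      ∑' ξ : ℤ, (c.phi ((2:ℝ) ^ (-j) * ξ) : ℂ) * fCoeff u ξ * Complex.exp (Complex.I * x * ξ)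

/-- The low-frequency cut-off `S_j u`. -/
def LPlow (c : LPCutoff) (j : ℤ) (u : ℝ → ℂ) (x : ℝ) : ℂ :=
  (1 / (2 * Real.pi)) *
    ∑' ξ : ℤ, (c.χ ((2:ℝ) ^ (-j) * ξ) : ℂ) * fCoeff u ξ * Complex.exp (Complex.I * x * ξ)

/-- The `L^∞(𝕋)` (sup) norm, with values in `ℝ≥0∞`. -/
def supNormE {E : Type*} [NormedAddCommGroup E] (f : ℝ → E) : ℝ≥0∞ :=
  ⨆ x : ℝ, (‖f x‖₊ : ℝ≥0∞)

/-- View a real-valued function as a complex-valued one. -/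
def toC (f : ℝ → ℝ) : ℝ → ℂ := fun x => (f x : ℂ)

/-- The `2π`-periodic square wave: `1/2` on `(0,π)`, `-1/2` on `(-π,0)`, `0` on `{-π,0,π}`. -/
def hFun (x : ℝ) : ℝ :=
  let y := x - 2 * Real.pi * ⌊(x + Real.pi) / (2 * Real.pi)⌋
  if y = 0 ∨ y = -Real.pi then 0 else if 0 < y then 1/2 else -1/2

/-- The low-frequency part `f_n = S_{n/2} h` (real-valued). -/
def fLow (c : LPCutoff) (n : ℕ) : ℝ → ℝ := fun x => (LPlow c ((n : ℤ) / 2) (toC hFun) x).re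

/-- The initial data `u_{0,n}` for the periodic Camassa–Holm equation. -/
def u0CH (c : LPCutoff) (n : ℕ) : ℝ → ℝ := fun x =>
  (2:ℝ) ^ (-(n:ℤ)) * (n:ℝ) ^ (-(2:ℝ)/5) * Real.log n * Real.cos ((2:ℝ) ^ (n:ℕ) * x) *
    (1 + (n:ℝ) ^ (-(1:ℝ)/5) * fLow c n x)

open intervalIntegral in
lemma int_cos_int (k : ℤ) :
    ∫ x in (-Real.pi)..Real.pi, Real.cos (k * x) = if k = 0 then 2 * Real.pi else 0 := by
  split_ifs with h
  · subst h; simp; ring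
  · have hk : (k : ℝ) ≠ 0 := by exact_mod_cast h
    rw [integral_comp_mul_left (fun x => Real.cos x) hk]
    simp [Real.sin_int_mul_pi]

lemma ii_of_cont {f : ℝ → ℝ} (hf : Continuous f) (a b : ℝ) :
    IntervalIntegrable f volume a b := hf.intervalIntegrable a b

lemma int_term (ξ m L : ℤ) (hL : |ξ| + |m| < 2 * L) :
    ∫ x in (-Real.pi)..Real.pi, Real.sin (ξ * x) * (Real.sin (m * x)
      - Real.cos (2 * L * x) * Real.sin (m * x)
      - (L : ℝ)⁻¹ * (Real.sin (2 * L * x) * (m * Real.cos (m * x)))) =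
    (if ξ = m then Real.pi else 0) - (if ξ = -m then Real.pi else 0) := by
  have h1 := abs_le.1 (le_refl |ξ|)
  have h2 := abs_le.1 (le_refl |m|)
  have e : ∀ x : ℝ, Real.sin (ξ * x) * (Real.sin (m * x)
      - Real.cos (2 * L * x) * Real.sin (m * x)
      - (L : ℝ)⁻¹ * (Real.sin (2 * L * x) * (m * Real.cos (m * x)))) =
      (1/2) * Real.cos ((ξ - m : ℤ) * x) + (-1/2) * Real.cos ((ξ + m : ℤ) * x)
      + (-1/4 - (L : ℝ)⁻¹ * m / 4 * (-1)) * Real.cos ((ξ - m + 2 * L : ℤ) * x)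
      + (-1/4 - (L : ℝ)⁻¹ * m / 4) * Real.cos ((ξ - m - 2 * L : ℤ) * x)
      + (1/4 - (L : ℝ)⁻¹ * m / 4 * (-1)) * Real.cos ((ξ + m + 2 * L : ℤ) * x)
      + (1/4 - (L : ℝ)⁻¹ * m / 4) * Real.cos ((ξ + m - 2 * L : ℤ) * x) := by
    intro x
    push_cast
    have a1 : ((ξ:ℝ) - m + 2 * L) * x = ξ * x - m * x + 2 * L * x := by ring
    have a2 : ((ξ:ℝ) - m - 2 * L) * x = ξ * x - m * x - 2 * L * x := by ring
    have a3 : ((ξ:ℝ) + m + 2 * L) * x = ξ * x + m * x + 2 * L * x := by ring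
    have a4 : ((ξ:ℝ) + m - 2 * L) * x = ξ * x + m * x - 2 * L * x := by ring
    rw [a1, a2, a3, a4, sub_mul, add_mul]
    simp only [Real.cos_add, Real.cos_sub, Real.sin_add, Real.sin_sub]
    ring
  simp_rw [e]
  have i : ∀ (a : ℝ) (k : ℤ), IntervalIntegrable (fun x : ℝ => a * Real.cos (k * x)) volume
      (-Real.pi) Real.pi := fun a k => ii_of_cont (by fun_prop) _ _
  rw [intervalIntegral.integral_add (((((i _ _).add (i _ _)).add (i _ _)).add (i _ _)).add (i _ _)) (i _ _),
    intervalIntegral.integral_add ((((i _ _).add (i _ _)).add (i _ _)).add (i _ _)) (i _ _),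
    intervalIntegral.integral_add (((i _ _).add (i _ _)).add (i _ _)) (i _ _),
    intervalIntegral.integral_add ((i _ _).add (i _ _)) (i _ _),
    intervalIntegral.integral_add (i _ _) (i _ _)]
  simp only [intervalIntegral.integral_const_mul, int_cos_int]
  rw [if_neg (show ¬ (ξ - m + 2 * L = 0) by omega), if_neg (show ¬ (ξ - m - 2 * L = 0) by omega),
    if_neg (show ¬ (ξ + m + 2 * L = 0) by omega), if_neg (show ¬ (ξ + m - 2 * L = 0) by omega)]
  have c1 : (ξ - m = 0) ↔ ξ = m := by omega
  have c2 : (ξ + m = 0) ↔ ξ = -m := by omega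
  simp only [c1, c2]
  split_ifs <;> ring

def tS (K : ℤ) (b : ℤ → ℝ) (x : ℝ) : ℝ := ∑ m ∈ Finset.Icc (-K) K, b m * Real.sin (m * x)
def tC (K : ℤ) (b : ℤ → ℝ) (x : ℝ) : ℝ :=
  ∑ m ∈ Finset.Icc (-K) K, b m * (m * Real.cos (m * x))

lemma tS_deriv (K : ℤ) (b : ℤ → ℝ) (x : ℝ) : HasDerivAt (tS K b) (tC K b x) x := by
  unfold tS tC
  apply HasDerivAt.fun_sum
  intro m _
  apply HasDerivAt.const_mul
  have := ((hasDerivAt_id x).const_mul (m:ℝ)).sin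
  simpa [mul_comm] using this

lemma tS_neg (K : ℤ) (b : ℤ → ℝ) (x : ℝ) : tS K b (-x) = - tS K b x := by
  simp [tS]

lemma tC_neg (K : ℤ) (b : ℤ → ℝ) (x : ℝ) : tC K b (-x) = tC K b x := by
  simp [tC]

lemma int_sum (ξ K L : ℤ) (b : ℤ → ℝ) (hb : ∀ m, b (-m) = - b m) (hK : |ξ| ≤ K) (hL : K < L) :
    ∫ x in (-Real.pi)..Real.pi, Real.sin (ξ * x) * (tS K b x
      - Real.cos (2 * L * x) * tS K b x
      - (L : ℝ)⁻¹ * (Real.sin (2 * L * x) * tC K b x)) = 2 * Real.pi * b ξ := by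
  have e : ∀ x : ℝ, Real.sin (ξ * x) * (tS K b x
      - Real.cos (2 * L * x) * tS K b x
      - (L : ℝ)⁻¹ * (Real.sin (2 * L * x) * tC K b x)) =
      ∑ m ∈ Finset.Icc (-K) K, b m * (Real.sin (ξ * x) * (Real.sin (m * x)
      - Real.cos (2 * L * x) * Real.sin (m * x)
      - (L : ℝ)⁻¹ * (Real.sin (2 * L * x) * (m * Real.cos (m * x))))) := by
    intro x
    simp only [tS, tC, Finset.mul_sum, ← Finset.sum_sub_distrib]
    refine Finset.sum_congr rfl fun m _ => by ring
  simp_rw [e]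
  rw [intervalIntegral.integral_finsetSum (fun m _ => ii_of_cont (by fun_prop) _ _)]
  have h1 := abs_le.1 hK
  rw [Finset.sum_congr rfl (g := fun m => (if m = ξ then Real.pi * b m else 0)
     - (if m = -ξ then Real.pi * b m else 0))]
  · rw [Finset.sum_sub_distrib, Finset.sum_ite_eq', Finset.sum_ite_eq', if_pos (by simp; omega),
      if_pos (by simp; omega), hb]
    ring
  · intro m hm
    rw [Finset.mem_Icc] at hm
    have : |m| ≤ K := abs_le.2 hm
    rw [intervalIntegral.integral_const_mul, int_term _ _ _ (by omega)]
    have c1 : (m = ξ) ↔ ξ = m := by omega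
    have c2 : (m = -ξ) ↔ ξ = -m := by omega
    simp only [c1, c2]
    split_ifs <;> ring

lemma int_odd_part (F : ℝ → ℝ) (hF : Continuous F) (ξ : ℤ) :
    ∫ x in (-Real.pi)..Real.pi, Real.sin (ξ * x) * F x =
    ∫ x in (-Real.pi)..Real.pi, Real.sin (ξ * x) * ((F x - F (-x)) / 2) := by
  have h : ∫ x in (-Real.pi)..Real.pi, Real.sin (ξ * x) * F x =
    ∫ x in (-Real.pi)..Real.pi, -(Real.sin (ξ * x) * F (-x)) := by
    have := intervalIntegral.integral_comp_neg (a := -Real.pi) (b := Real.pi)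
      (fun x => Real.sin (ξ * x) * F x)
    rw [neg_neg] at this
    rw [← this]
    simp
  have e : ∀ x, Real.sin (ξ * x) * ((F x - F (-x)) / 2) = (1/2) * (Real.sin (ξ * x) * F x)
    + (1/2) * (-(Real.sin (ξ * x) * F (-x))) := by intro x; ring
  simp_rw [e]
  rw [intervalIntegral.integral_add (ii_of_cont (by fun_prop) _ _) (ii_of_cont (by fun_prop) _ _),
    intervalIntegral.integral_const_mul, intervalIntegral.integral_const_mul, ← h]
  ring

lemma ibp (w : ℝ → ℝ) (hp : Function.Periodic w (2 * Real.pi)) (hw : ContDiff ℝ 2 w) (ξ : ℤ) :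
    (1 + (ξ:ℝ)^2) * ∫ x in (-Real.pi)..Real.pi, Real.cos (ξ * x) * deriv w x =
    ξ * ∫ x in (-Real.pi)..Real.pi, Real.sin (ξ * x) * (w x - deriv (deriv w) x) := by
  have hd1 : Differentiable ℝ w := hw.differentiable (by norm_num)
  have hw1 : ContDiff ℝ 1 (deriv w) := by
    have : ContDiff ℝ (1 + 1) w := by simpa [one_add_one_eq_two] using hw
    exact (contDiff_succ_iff_deriv.1 this).2.2
  have hd2 : Differentiable ℝ (deriv w) := hw1.differentiable (by norm_num)
  have c0 : Continuous w := hd1.continuous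
  have c1 : Continuous (deriv w) := hd2.continuous
  have c2 : Continuous (deriv (deriv w)) := hw1.continuous_deriv (by norm_num)
  have p1 : w Real.pi = w (-Real.pi) := by
    have := hp (-Real.pi); rw [← this]; congr 1; ring
  have hs : ∀ x : ℝ, HasDerivAt (fun x : ℝ => Real.sin (ξ * x)) (ξ * Real.cos (ξ * x)) x := by
    intro x
    have := ((hasDerivAt_id x).const_mul (ξ:ℝ)).sin
    simpa [mul_comm] using this
  have hc : ∀ x : ℝ, HasDerivAt (fun x : ℝ => Real.cos (ξ * x)) (-(ξ * Real.sin (ξ * x))) x := by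
    intro x
    have := ((hasDerivAt_id x).const_mul (ξ:ℝ)).cos
    simpa [mul_comm] using this
  have e1 := intervalIntegral.integral_mul_deriv_eq_deriv_mul (a := -Real.pi) (b := Real.pi)
    (fun x _ => hc x) (fun x _ => (hd1 x).hasDerivAt) (ii_of_cont (by fun_prop) _ _)
    (ii_of_cont c1 _ _)
  have e2 := intervalIntegral.integral_mul_deriv_eq_deriv_mul (a := -Real.pi) (b := Real.pi)
    (fun x _ => hs x) (fun x _ => (hd2 x).hasDerivAt) (ii_of_cont (by fun_prop) _ _)
    (ii_of_cont c2 _ _)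
  have e3 : ∫ x in (-Real.pi)..Real.pi, -(ξ * Real.sin (ξ * x)) * w x =
     -(ξ * ∫ x in (-Real.pi)..Real.pi, Real.sin (ξ * x) * w x) := by
    rw [← intervalIntegral.integral_const_mul, ← intervalIntegral.integral_neg]
    congr 1; ext x; ring
  have e4 : ∫ x in (-Real.pi)..Real.pi, (ξ * Real.cos (ξ * x)) * deriv w x =
     ξ * ∫ x in (-Real.pi)..Real.pi, Real.cos (ξ * x) * deriv w x := by
    rw [← intervalIntegral.integral_const_mul]
    congr 1; ext x; ring
  have e5 : ∫ x in (-Real.pi)..Real.pi, Real.sin (ξ * x) * (w x - deriv (deriv w) x) =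
    (∫ x in (-Real.pi)..Real.pi, Real.sin (ξ * x) * w x) -
    ∫ x in (-Real.pi)..Real.pi, Real.sin (ξ * x) * deriv (deriv w) x := by
    rw [← intervalIntegral.integral_sub (ii_of_cont (by fun_prop) _ _)
      (ii_of_cont (by fun_prop) _ _)]
    congr 1; ext x; ring
  rw [e3, p1] at e1
  rw [e4] at e2
  rw [e5, e2]
  simp only [mul_neg, Real.cos_neg, Real.sin_neg, Real.sin_int_mul_pi] at e1 ⊢
  linear_combination e1

lemma fCoeff_re (u : ℝ → ℝ) (hu : Continuous u) (ξ : ℤ) :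
    (fCoeff (toC u) ξ).re = ∫ x in (-Real.pi)..Real.pi, Real.cos (ξ * x) * u x := by
  have hc : Continuous (fun x : ℝ => Complex.exp (-Complex.I * x * ξ) * toC u x) := by
    unfold toC; fun_prop
  have := Complex.reCLM.intervalIntegral_comp_comm (hc.intervalIntegrable (μ := volume) (-Real.pi) Real.pi)
  unfold fCoeff
  simp only [Complex.reCLM_apply] at this
  rw [← this]
  congr 1; ext x
  simp [toC, Complex.exp_re, mul_comm]

def sC (ξ : ℤ) : ℝ := ∫ x in (0:ℝ)..Real.pi, Real.sin (ξ * x)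

lemma sC_neg (ξ : ℤ) : sC (-ξ) = - sC ξ := by
  simp [sC]

lemma mul_sC (ξ : ℤ) : ξ * sC ξ = 1 - Real.cos (ξ * Real.pi) := by
  by_cases h : ξ = 0
  · simp [h]
  · have hk : (ξ : ℝ) ≠ 0 := by exact_mod_cast h
    unfold sC
    rw [intervalIntegral.integral_comp_mul_left (fun x => Real.sin x) hk]
    simp [hk]

lemma hFun_pos (x : ℝ) (hx : 0 < x) (hx' : x < Real.pi) : hFun x = 1/2 := by
  have hpi := Real.pi_pos
  have : ⌊(x + Real.pi) / (2 * Real.pi)⌋ = 0 := by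
    rw [Int.floor_eq_zero_iff]
    constructor
    · positivity
    · rw [div_lt_one (by positivity)]; linarith
  simp only [hFun, this]
  rw [if_neg, if_pos]
  · simpa
  · simp; constructor <;> linarith

lemma hFun_neg (x : ℝ) (hx : -Real.pi < x) (hx' : x < 0) : hFun x = -1/2 := by
  have hpi := Real.pi_pos
  have : ⌊(x + Real.pi) / (2 * Real.pi)⌋ = 0 := by
    rw [Int.floor_eq_zero_iff]
    constructor
    · apply div_nonneg <;> linarith
    · rw [div_lt_one (by positivity)]; linarith
  simp only [hFun, this]
  rw [if_neg, if_neg]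
  · simp; linarith
  · simp; constructor <;> linarith

lemma fCoeff_h (ξ : ℤ) : fCoeff (toC hFun) ξ = -Complex.I * (sC ξ : ℂ) := by
  have hpi := Real.pi_pos
  unfold fCoeff
  have a1 : ∀ᵐ x : ℝ, x ≠ Real.pi := by simp [ae_iff, measure_singleton]
  have a2 : ∀ᵐ x : ℝ, x ≠ 0 := by simp [ae_iff, measure_singleton]
  have k1 : ∀ᵐ x : ℝ, x ∈ Set.uIoc (-Real.pi) 0 →
     Complex.exp (-Complex.I * x * ξ) * (-1/2) = Complex.exp (-Complex.I * x * ξ) * toC hFun x := by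
    filter_upwards [a2] with x h0 hx
    rw [Set.uIoc_of_le (by linarith), Set.mem_Ioc] at hx
    rw [toC, hFun_neg x hx.1 (lt_of_le_of_ne hx.2 h0)]
    push_cast; rfl
  have k2 : ∀ᵐ x : ℝ, x ∈ Set.uIoc 0 Real.pi →
     Complex.exp (-Complex.I * x * ξ) * (1/2) = Complex.exp (-Complex.I * x * ξ) * toC hFun x := by
    filter_upwards [a1] with x h0 hx
    rw [Set.uIoc_of_le (by linarith), Set.mem_Ioc] at hx
    rw [toC, hFun_pos x hx.1 (lt_of_le_of_ne hx.2 h0)]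
    push_cast; rfl
  have c1 : Continuous (fun x : ℝ => Complex.exp (-Complex.I * x * ξ) * (-1/2)) := by fun_prop
  have c2 : Continuous (fun x : ℝ => Complex.exp (-Complex.I * x * ξ) * (1/2)) := by fun_prop
  have i1 := (c1.intervalIntegrable (μ := volume) (-Real.pi) 0).congr_ae
    ((ae_restrict_iff' measurableSet_uIoc).2 k1)
  have i2 := (c2.intervalIntegrable (μ := volume) 0 Real.pi).congr_ae
    ((ae_restrict_iff' measurableSet_uIoc).2 k2)
  rw [← intervalIntegral.integral_add_adjacent_intervals i1 i2,
    ← intervalIntegral.integral_congr_ae k1, ← intervalIntegral.integral_congr_ae k2]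
  have hneg := intervalIntegral.integral_comp_neg (a := 0) (b := Real.pi)
    (fun x : ℝ => Complex.exp (-Complex.I * x * ξ) * (-1/2))
  rw [neg_zero] at hneg
  have c3 : Continuous (fun x : ℝ => Complex.exp (-Complex.I * (-x : ℝ) * ξ) * (-1/2)) := by fun_prop
  rw [← hneg, ← intervalIntegral.integral_add (c3.intervalIntegrable _ _) (c2.intervalIntegrable _ _),
    sC, ← intervalIntegral.integral_ofReal, ← intervalIntegral.integral_const_mul]
  congr 1; ext x
  have : Complex.sin (ξ * x) = (Complex.exp (-Complex.I * x * ξ) - Complex.exp (Complex.I * x * ξ)) * Complex.I / 2 := by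
    rw [Complex.sin]; congr 4 <;> ring_nf
  push_cast
  rw [this]
  have hI := Complex.I_sq
  have : -Complex.I * -(x:ℂ) * ξ = Complex.I * x * ξ := by ring
  rw [this]
  linear_combination (1/2 * (Complex.exp (-Complex.I * x * ξ) - Complex.exp (Complex.I * x * ξ))) * hI

lemma chi_zero (c : LPCutoff) (x : ℝ) (h : 4/3 ≤ |x|) : c.χ x = 0 := by
  by_contra hx
  have := c.supp x hx
  have := abs_lt.2 this
  linarith

lemma chi_one (c : LPCutoff) (x : ℝ) (h : |x| ≤ 3/4) : c.χ x = 1 :=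
  c.eq_one x (abs_le.1 h)

lemma chi_abs (c : LPCutoff) (x : ℝ) : c.χ |x| = c.χ x := by
  rcases abs_choice x with h | h <;> rw [h]
  exact c.even x

lemma phi_nonneg (c : LPCutoff) (x : ℝ) : 0 ≤ c.phi x := by
  unfold LPCutoff.phi
  rw [← chi_abs c x, ← chi_abs c (x/2), sub_nonneg]
  apply c.decay (by simp) (by simp)
  rw [abs_div, abs_two]
  linarith [abs_nonneg x]

lemma phi_zero (c : LPCutoff) (x : ℝ) (h : 8/3 ≤ |x|) : c.phi x = 0 := by
  unfold LPCutoff.phi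
  rw [chi_zero c x (by linarith), chi_zero c (x/2) (by rw [abs_div, abs_two]; linarith), sub_zero]

lemma phi_one (c : LPCutoff) (x : ℝ) (h : 4/3 ≤ |x|) (h' : |x| ≤ 3/2) : c.phi x = 1 := by
  unfold LPCutoff.phi
  rw [chi_zero c x (by linarith), chi_one c (x/2) (by rw [abs_div, abs_two]; linarith), sub_zero]

lemma scale_abs (a : ℕ) (t : ℕ) (m : ℤ) (hm : m ∉ Finset.Icc (-(2:ℤ)^(a+t)) (2^(a+t))) :
    (2:ℝ)^t ≤ |(2:ℝ)^(-(a:ℤ)) * m| := by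
  have h : (2:ℤ)^(a+t) ≤ |m| := by
    by_contra h
    push Not at h
    exact hm (Finset.mem_Icc.2 ⟨(abs_lt.1 h).1.le, (abs_lt.1 h).2.le⟩)
  have h' : (2:ℝ)^(a+t) ≤ |(m:ℝ)| := by exact_mod_cast h
  rw [abs_mul, abs_of_pos (by positivity), zpow_neg, zpow_natCast, ← div_eq_inv_mul,
    le_div_iff₀ (by positivity), ← pow_add, add_comm]
  exact h'

def bC (c : LPCutoff) (a : ℕ) (m : ℤ) : ℝ :=
  1 / (2 * Real.pi) * (c.χ ((2:ℝ) ^ (-(a:ℤ)) * m) * sC m)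

lemma bC_neg (c : LPCutoff) (a : ℕ) (m : ℤ) : bC c a (-m) = - bC c a m := by
  unfold bC
  rw [sC_neg]
  rw [Int.cast_neg, mul_neg ((2:ℝ) ^ (-(a:ℤ))), c.even]
  ring

lemma fLow_eq (c : LPCutoff) (k : ℕ) :
    fLow c (16 * k) = tS (2^(8*k+1)) (bC c (8*k)) := by
  ext x
  have hn : ((16 * k : ℕ) : ℤ) / 2 = ((8 * k : ℕ) : ℤ) := by omega
  unfold fLow LPlow tS
  rw [hn, tsum_eq_sum (s := Finset.Icc (-(2:ℤ)^(8*k+1)) (2^(8*k+1)))]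
  · rw [Finset.mul_sum, Complex.re_sum]
    refine Finset.sum_congr rfl fun m _ => ?_
    rw [fCoeff_h]
    have : Complex.exp (Complex.I * x * m) = (Real.cos (m * x) : ℂ) + (Real.sin (m * x) : ℂ) * Complex.I := by
      push_cast
      rw [← Complex.exp_mul_I]; congr 1; ring
    rw [this]
    have e : (1 / (2 * (Real.pi:ℂ))) * (((c.χ ((2:ℝ) ^ (-((8 * k : ℕ) : ℤ)) * m) : ℝ) : ℂ) * (-Complex.I * (sC m : ℂ)) *
       ((Real.cos (m * x) : ℂ) + (Real.sin (m * x) : ℂ) * Complex.I)) =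
       ((bC c (8*k) m * Real.sin (m * x) : ℝ) : ℂ) + ((-bC c (8*k) m * Real.cos (m * x) : ℝ) : ℂ) * Complex.I := by
      unfold bC
      generalize c.χ ((2:ℝ) ^ (-((8 * k : ℕ) : ℤ)) * m) = z
      push_cast
      linear_combination (-(1 / (2 * (Real.pi:ℂ))) * ((z:ℂ) * (sC m : ℂ) * (Complex.sin (m * x)))) * Complex.I_sq
    rw [e, Complex.add_re, Complex.re_ofReal_mul, Complex.ofReal_re, Complex.I_re]
    simp
  · intro m hm
    rw [chi_zero c _ (by have := scale_abs (8*k) 1 m hm; linarith)]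
    simp

lemma deriv_u0 (c : LPCutoff) (k : ℕ) (x : ℝ) (f g : ℝ → ℝ) (hf : fLow c (16 * k) = f)
    (hg : ∀ x, HasDerivAt f (g x) x) (A ε L : ℝ)
    (hA : A = ((16*k : ℕ):ℝ) ^ (-(2:ℝ)/5) * Real.log (16*k : ℕ))
    (hε : ε = ((16*k : ℕ):ℝ) ^ (-(1:ℝ)/5)) (hL : L = 2^(16*k)) :
    deriv (u0CH c (16 * k)) x =
      A * (-Real.sin (L * x) * (1 + ε * f x) + L⁻¹ * Real.cos (L * x) * (ε * g x)) := by
  have hL0 : L ≠ 0 := by rw [hL]; positivity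
  have hu : u0CH c (16 * k) = fun x => (L⁻¹ * A) * (Real.cos (L * x) * (1 + ε * f x)) := by
    ext x
    unfold u0CH
    rw [hf, hA, hε, hL, zpow_neg, zpow_natCast]
    ring
  have h1 : HasDerivAt (fun x : ℝ => Real.cos (L * x)) (-(L * Real.sin (L * x))) x := by
    have := ((hasDerivAt_id x).const_mul L).cos
    simpa [mul_comm] using this
  have h2 : HasDerivAt (fun x : ℝ => 1 + ε * f x) (ε * g x) x :=
    ((hg x).const_mul ε).const_add 1
  have h3 : HasDerivAt (fun x => (L⁻¹ * A) * (Real.cos (L * x) * (1 + ε * f x))) _ x :=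
    (h1.mul h2).const_mul (L⁻¹ * A)
  rw [hu, h3.deriv]
  field_simp

lemma int_F (c : LPCutoff) (k : ℕ) (hk : 1 ≤ k) (ξ : ℤ) (hξ : |ξ| ≤ 2^(8*k+1)) (F : ℝ → ℝ)
    (hF : Continuous F) (hFe : ∀ x, F x = (deriv (u0CH c (16*k)) x)^2) :
    ∫ x in (-Real.pi)..Real.pi, Real.sin (ξ * x) * F x =
      ((16*k : ℕ):ℝ)⁻¹ * (Real.log (16*k : ℕ))^2 * (2 * Real.pi * bC c (8*k) ξ) := by
  set A := ((16*k : ℕ):ℝ) ^ (-(2:ℝ)/5) * Real.log (16*k : ℕ) with hA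
  set ε := ((16*k : ℕ):ℝ) ^ (-(1:ℝ)/5) with hε
  set L : ℤ := 2^(16*k) with hL
  set K : ℤ := 2^(8*k+1) with hK
  set b := bC c (8*k) with hb
  have hAe : A^2 * ε = ((16*k : ℕ):ℝ)⁻¹ * (Real.log (16*k : ℕ))^2 := by
    have h0 : (0:ℝ) < ((16*k : ℕ):ℝ) := by positivity
    have : (((16*k : ℕ):ℝ) ^ (-(2:ℝ)/5))^2 * ((16*k : ℕ):ℝ) ^ (-(1:ℝ)/5) = ((16*k : ℕ):ℝ)⁻¹ := by
      rw [← Real.rpow_natCast, ← Real.rpow_mul h0.le, ← Real.rpow_add h0, ← Real.rpow_neg_one]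
      norm_num
    rw [hA, hε, ← this]; ring
  have hD : ∀ x, deriv (u0CH c (16*k)) x = A * (-Real.sin (L * x) * (1 + ε * tS K b x)
      + (L:ℝ)⁻¹ * Real.cos (L * x) * (ε * tC K b x)) := fun x =>
    deriv_u0 c k x _ _ (fLow_eq c k) (tS_deriv K b) A ε L hA hε (by rw [hL]; push_cast; rfl)
  have hKL : K < L := by
    rw [hK, hL]; exact pow_lt_pow_right₀ (by norm_num) (by omega)
  rw [int_odd_part F hF, ← hAe, ← int_sum ξ K L b (bC_neg c _) hξ hKL,
    ← intervalIntegral.integral_const_mul]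
  congr 1; ext x
  rw [hFe, hFe, hD, hD, tS_neg, tC_neg]
  have a : 2 * (L:ℝ) * x = 2 * (L * x) := by ring
  rw [a, Real.cos_two_mul, Real.sin_two_mul, mul_neg, Real.sin_neg, Real.cos_neg]
  have := Real.sin_sq_add_cos_sq (L * x)
  linear_combination (2 * A^2 * ε * Real.sin (ξ * x) * tS K b x) * this

lemma block_re (c : LPCutoff) (j : ℕ) (v : ℝ → ℝ) (hv : Continuous v) :
    (LPblock c (j:ℤ) (toC v) 0).re = 1 / (2 * Real.pi) *
      ∑ ξ ∈ Finset.Icc (-(2:ℤ)^(j+2)) (2^(j+2)), c.phi ((2:ℝ)^(-(j:ℤ)) * ξ) *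
        ∫ x in (-Real.pi)..Real.pi, Real.cos (ξ * x) * v x := by
  unfold LPblock
  rw [if_neg (by omega), tsum_eq_sum (s := Finset.Icc (-(2:ℤ)^(j+2)) (2^(j+2)))]
  · have e : (1 / (2 * (Real.pi:ℂ))) = ((1 / (2 * Real.pi) : ℝ) : ℂ) := by push_cast; rfl
    rw [e, Complex.re_ofReal_mul, Complex.re_sum]
    congr 1
    refine Finset.sum_congr rfl fun m _ => ?_
    rw [← fCoeff_re v hv]
    simp
  · intro m hm
    rw [phi_zero c _ (by have := scale_abs j 2 m hm; linarith)]
    simp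

lemma sum_lower (c : LPCutoff) (i a : ℕ) (ha : i + 5 ≤ a) :
    (2:ℝ)^(-(i+4:ℤ)) / 32 ≤ ∑ ξ ∈ Finset.Icc (-(2:ℤ)^(i+4+2)) (2^(i+4+2)),
      c.phi ((2:ℝ)^(-((i+4:ℕ):ℤ)) * ξ) * (c.χ ((2:ℝ)^(-(a:ℤ)) * ξ) * (ξ * sC ξ) / (1 + (ξ:ℝ)^2)) := by
  have hnn : ∀ ξ : ℤ, 0 ≤ c.phi ((2:ℝ)^(-((i+4:ℕ):ℤ)) * ξ) *
      (c.χ ((2:ℝ)^(-(a:ℤ)) * ξ) * (ξ * sC ξ) / (1 + (ξ:ℝ)^2)) := by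
    intro ξ
    rw [mul_sC]
    have := phi_nonneg c ((2:ℝ)^(-((i+4:ℕ):ℤ)) * ξ)
    have := c.nonneg ((2:ℝ)^(-(a:ℤ)) * ξ)
    have : 0 ≤ 1 - Real.cos (ξ * Real.pi) := by linarith [Real.cos_le_one (ξ * Real.pi)]
    positivity
  let S : Finset ℤ := (Finset.Ico (11 * (2:ℤ)^i) (12 * 2^i)).image (fun m => 2 * m + 1)
  have hi : (0:ℤ) < 2^i := by positivity
  have hiR : (0:ℝ) < 2^i := by positivity
  have hSsub : S ⊆ Finset.Icc (-(2:ℤ)^(i+4+2)) (2^(i+4+2)) := by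
    intro ξ hξ
    simp only [S, Finset.mem_image, Finset.mem_Ico] at hξ
    obtain ⟨m, hm, rfl⟩ := hξ
    have : (2:ℤ)^(i+4+2) = 64 * 2^i := by ring
    rw [Finset.mem_Icc, this]; omega
  have hcard : S.card = 2^i := by
    rw [Finset.card_image_of_injective _ (fun a b h => by simpa using h), Int.card_Ico]
    have : 12 * (2:ℤ)^i - 11 * 2^i = ((2^i : ℕ) : ℤ) := by push_cast; ring
    rw [this, Int.toNat_natCast]
  refine le_trans ?_ (Finset.sum_le_sum_of_subset_of_nonneg hSsub (fun ξ _ _ => hnn ξ))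
  have hterm : ∀ ξ ∈ S, 1 / (2 * (256 * ((2:ℝ)^i)^2)) ≤ c.phi ((2:ℝ)^(-((i+4:ℕ):ℤ)) * ξ) *
      (c.χ ((2:ℝ)^(-(a:ℤ)) * ξ) * (ξ * sC ξ) / (1 + (ξ:ℝ)^2)) := by
    intro ξ hξ
    simp only [S, Finset.mem_image, Finset.mem_Ico] at hξ
    obtain ⟨m, hm, rfl⟩ := hξ
    have m1 : 11 * (2:ℝ)^i ≤ m := by exact_mod_cast hm.1
    have m2 : (m:ℝ) + 1 ≤ 12 * (2:ℝ)^i := by exact_mod_cast hm.2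
    set y : ℝ := ((2 * m + 1 : ℤ) : ℝ) with hy
    have hy' : y = 2 * m + 1 := by rw [hy]; push_cast; ring
    have y1 : 22 * (2:ℝ)^i ≤ y := by linarith
    have y2 : y ≤ 24 * (2:ℝ)^i := by linarith
    have y0 : 0 < y := by linarith
    have hφ : c.phi ((2:ℝ)^(-((i+4:ℕ):ℤ)) * y) = 1 := by
      have e : (2:ℝ)^(-((i+4:ℕ):ℤ)) * y = y / (16 * 2^i) := by
        rw [zpow_neg, zpow_natCast, pow_add]; field_simp; norm_num
      rw [e]
      apply phi_one <;> rw [abs_of_pos (by positivity)]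
      · rw [le_div_iff₀ (by positivity)]; linarith
      · rw [div_le_iff₀ (by positivity)]; linarith
    have hχ : c.χ ((2:ℝ)^(-(a:ℤ)) * y) = 1 := by
      apply chi_one
      rw [abs_of_pos (by positivity), zpow_neg, zpow_natCast, ← div_eq_inv_mul,
        div_le_iff₀ (by positivity)]
      have : (2:ℝ)^(i+5) ≤ 2^a := pow_le_pow_right₀ (by norm_num) ha
      rw [pow_add] at this
      linarith
    have hs : y * sC (2 * m + 1) = 2 := by
      rw [hy, mul_sC]
      have : ((2 * m + 1 : ℤ) : ℝ) * Real.pi = Real.pi + m * (2 * Real.pi) := by push_cast; ring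
      rw [this, Real.cos_add_int_mul_two_pi, Real.cos_pi]; norm_num
    rw [hφ, hχ, hs, one_mul, one_mul]
    rw [div_le_div_iff₀ (by positivity) (by positivity)]
    have h1 : (1:ℝ) ≤ 2^i := one_le_pow₀ (by norm_num)
    nlinarith
  refine le_trans ?_ (Finset.card_nsmul_le_sum S _ _ hterm)
  rw [hcard, nsmul_eq_mul]
  have e : (2:ℝ)^(-(i+4:ℤ)) = (16 * 2^i)⁻¹ := by
    rw [zpow_neg, zpow_add₀ (by norm_num), zpow_natCast]; norm_num; ring
  rw [e]
  push_cast
  apply le_of_eq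
  field_simp
  norm_num

lemma block_lower (c : LPCutoff) (k : ℕ) (hk : 2 ≤ k) (w : ℝ → ℝ)
    (hp : Function.Periodic w (2 * Real.pi)) (hw : ContDiff ℝ 2 w)
    (he : ∀ x, w x - deriv (deriv w) x = (deriv (u0CH c (16*k)) x) ^ 2)
    (i : ℕ) (hi : i + 4 ≤ 4 * k) :
    ((16*k : ℕ):ℝ)⁻¹ * (Real.log (16*k : ℕ))^2 * (1 / (64 * Real.pi)) * (2:ℝ)^(-(i+4:ℤ)) ≤
      ‖LPblock c ((i+4:ℕ):ℤ) (toC (deriv w)) 0‖ := by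
  have hw1 : ContDiff ℝ 1 (deriv w) := by
    have : ContDiff ℝ (1 + 1) w := by simpa [one_add_one_eq_two] using hw
    exact (contDiff_succ_iff_deriv.1 this).2.2
  have c1 : Continuous (deriv w) := hw1.continuous
  have c2 : Continuous (deriv (deriv w)) := hw1.continuous_deriv (by norm_num)
  have c0 : Continuous w := hw.continuous
  refine le_trans ?_ (le_trans (le_abs_self _) (Complex.abs_re_le_norm _))
  rw [block_re c _ _ c1]
  set B := ((16*k : ℕ):ℝ)⁻¹ * (Real.log (16*k : ℕ))^2 with hB
  have hB0 : 0 ≤ B := by positivity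
  have hsum : ∑ ξ ∈ Finset.Icc (-(2:ℤ)^(i+4+2)) (2^(i+4+2)), c.phi ((2:ℝ)^(-((i+4:ℕ):ℤ)) * ξ) *
        ∫ x in (-Real.pi)..Real.pi, Real.cos (ξ * x) * deriv w x =
      B * ∑ ξ ∈ Finset.Icc (-(2:ℤ)^(i+4+2)) (2^(i+4+2)), c.phi ((2:ℝ)^(-((i+4:ℕ):ℤ)) * ξ) *
        (c.χ ((2:ℝ)^(-((8*k:ℕ):ℤ)) * ξ) * (ξ * sC ξ) / (1 + (ξ:ℝ)^2)) := by
    rw [Finset.mul_sum]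
    refine Finset.sum_congr rfl fun ξ hξ => ?_
    rw [Finset.mem_Icc] at hξ
    have hle : (2:ℤ)^(i+4+2) ≤ 2^(8*k+1) := pow_le_pow_right₀ (by norm_num) (by omega)
    have h1 := ibp w hp hw ξ
    rw [int_F c k (by omega) ξ ((abs_le.2 hξ).trans hle) (fun x => w x - deriv (deriv w) x)
      (c0.sub c2) he] at h1
    have hx : (1 + (ξ:ℝ)^2) ≠ 0 := by positivity
    have h2 : ∫ x in (-Real.pi)..Real.pi, Real.cos (ξ * x) * deriv w x =
       B * (c.χ ((2:ℝ)^(-((8*k:ℕ):ℤ)) * ξ) * (ξ * sC ξ) / (1 + (ξ:ℝ)^2)) := by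
      rw [← mul_div_assoc, eq_div_iff hx, mul_comm, h1, ← hB, bC]
      have := Real.pi_ne_zero
      field_simp
    rw [h2]; ring
  rw [hsum]
  have := sum_lower c i (8*k) (by omega)
  have h3 := mul_le_mul_of_nonneg_left this (show 0 ≤ 1 / (2 * Real.pi) * B by positivity)
  refine le_trans (le_of_eq ?_) (h3.trans (le_of_eq ?_))
  · have := Real.pi_ne_zero
    field_simp
    ring
  · ring

theorem helmholtz_deriv_lower_bound (c : LPCutoff) :
    ∃ c₀ : ℝ, 0 < c₀ ∧ ∃ N : ℕ, ∀ n : ℕ, 16 ∣ n → N ≤ n →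
      ∀ w : ℝ → ℝ, Function.Periodic w (2 * Real.pi) → ContDiff ℝ 2 w →
        (∀ x, w x - deriv (deriv w) x = (deriv (u0CH c n) x) ^ 2) →
        ENNReal.ofReal (c₀ * (Real.log n) ^ 2) ≤
          ∑ j ∈ Finset.Icc (n / 8) (n / 4),
            (2:ℝ≥0∞) ^ (j : ℕ) * supNormE (LPblock c (j : ℤ) (toC (deriv w))) := by
  refine ⟨1 / (512 * Real.pi), by positivity, 32, ?_⟩
  rintro n ⟨k, rfl⟩ hn w hp hw he
  have hk : 2 ≤ k := by omega
  set B := ((16*k : ℕ):ℝ)⁻¹ * (Real.log (16*k : ℕ))^2 * (1 / (64 * Real.pi)) with hB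
  have hterm : ∀ j ∈ Finset.Icc (16 * k / 8) (16 * k / 4), ENNReal.ofReal B ≤
      (2:ℝ≥0∞) ^ (j : ℕ) * supNormE (LPblock c (j : ℤ) (toC (deriv w))) := by
    intro j hj
    rw [Finset.mem_Icc] at hj
    obtain ⟨i, rfl⟩ : ∃ i, j = i + 4 := ⟨j - 4, by omega⟩
    have h := block_lower c k hk w hp hw he i (by omega)
    have h2 : B ≤ (2:ℝ)^(i+4) * ‖LPblock c ((i+4:ℕ):ℤ) (toC (deriv w)) 0‖ := by
      have := mul_le_mul_of_nonneg_left h (show (0:ℝ) ≤ 2^(i+4) by positivity)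
      refine le_trans (le_of_eq ?_) this
      have e : (2:ℝ)^(-(i+4:ℤ)) = (2^(i+4))⁻¹ := by
        rw [zpow_neg]; norm_cast
      rw [e, ← hB]
      field_simp
    refine (ENNReal.ofReal_le_ofReal h2).trans ?_
    rw [ENNReal.ofReal_mul (by positivity), ENNReal.ofReal_pow (by norm_num), ENNReal.ofReal_ofNat]
    gcongr
    rw [ofReal_norm]
    exact le_iSup (fun x : ℝ => (‖LPblock c ((i+4:ℕ):ℤ) (toC (deriv w)) x‖₊ : ℝ≥0∞)) 0
  refine le_trans ?_ (Finset.card_nsmul_le_sum _ _ _ hterm)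
  rw [Nat.card_Icc, nsmul_eq_mul, ← ENNReal.ofReal_natCast, ← ENNReal.ofReal_mul (by positivity)]
  apply ENNReal.ofReal_le_ofReal
  have hcount : (2 * k : ℝ) ≤ ((16 * k / 4 + 1 - 16 * k / 8 : ℕ) : ℝ) := by
    have : 2 * k ≤ 16 * k / 4 + 1 - 16 * k / 8 := by omega
    exact_mod_cast this
  refine le_trans (le_of_eq ?_) (mul_le_mul_of_nonneg_right hcount (by positivity))
  rw [hB]
  have : (k:ℝ) ≠ 0 := by positivity
  have := Real.pi_ne_zero
  push_cast
  field_simp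
  ring
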